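/- Let A be a proper assignment set for a closed walk W in the brickwall 𝓑, and let p be the number of PA-indices of W. Then the number of elementary cycles of (W, A) is p/2 + 1. -/

import Mathlib

open scoped Classical

namespace Hex

/-- Adjacency in the brickwall `𝓑`: vertex `(i,j)` is `b_{i,j}`.
Horizontal edges `b_{i,j} b_{i+1,j}` for all `i,j`, and vertical edges
`b_{i,j} b_{i+1,j+1}` for odd `i`. -/
def bwAdj (u v : ℤ × ℤ) : Prop :=
  (u.2 = v.2 ∧ (v.1 = u.1 + 1 ∨ u.1 = v.1 + 1)) ∨
  (Odd u.1 ∧ v.1 = u.1 + 1 ∧ v.2 = u.2 + 1) ∨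
  (Odd v.1 ∧ u.1 = v.1 + 1 ∧ u.2 = v.2 + 1)

/-- A closed walk of length `k` in the brickwall, represented by a `k`-periodic
function `f : ℤ → ℤ × ℤ` (so `W_i = f i`), with adjacency and no turning back. -/
def IsClosedWalk (k : ℕ) (f : ℤ → ℤ × ℤ) : Prop :=
  0 < k ∧ (∀ i : ℤ, f (i + (k : ℤ)) = f i) ∧ (∀ i : ℤ, bwAdj (f i) (f (i + 1))) ∧
    (∀ i : ℤ, f (i - 1) ≠ f (i + 1))

/-- The neighbor of `v` immediately following `u` in the clockwise order
around `v` in the planar drawing of the brickwall: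
around `b_{i,j}` with `i` odd the clockwise order is
`(b_{i+1,j+1}, b_{i+1,j}, b_{i-1,j})`, and with `i` even it is
`(b_{i+1,j}, b_{i-1,j-1}, b_{i-1,j})`. -/
def cwNext (v u : ℤ × ℤ) : ℤ × ℤ :=
  if v.1 % 2 = 0 then
    (if u = (v.1 + 1, v.2) then (v.1 - 1, v.2 - 1)
     else if u = (v.1 - 1, v.2 - 1) then (v.1 - 1, v.2)
     else (v.1 + 1, v.2))
  else
    (if u = (v.1 + 1, v.2 + 1) then (v.1 + 1, v.2)
     else if u = (v.1 + 1, v.2) then (v.1 - 1, v.2)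
     else (v.1 + 1, v.2 + 1))

/-- `W` makes a right turn at `i`: `W_{i-1}` immediately follows `W_{i+1}` clockwise. -/
def RightTurn (f : ℤ → ℤ × ℤ) (i : ℤ) : Prop := f (i - 1) = cwNext (f i) (f (i + 1))

/-- `W` makes a left turn at `i`: `W_{i+1}` immediately follows `W_{i-1}` clockwise. -/
def LeftTurn (f : ℤ → ℤ × ℤ) (i : ℤ) : Prop := f (i + 1) = cwNext (f i) (f (i - 1))

noncomputable def rightCount (k : ℕ) (f : ℤ → ℤ × ℤ) : ℕ :=
  ((Finset.range k).filter fun t => RightTurn f (t : ℤ)).card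

noncomputable def leftCount (k : ℕ) (f : ℤ → ℤ × ℤ) : ℕ :=
  ((Finset.range k).filter fun t => LeftTurn f (t : ℤ)).card

/-- The turning number `t(W) = (Right(W) - Left(W))/6`. -/
noncomputable def turningNumber (k : ℕ) (f : ℤ → ℤ × ℤ) : ℚ :=
  ((rightCount k f : ℚ) - (leftCount k f : ℚ)) / 6

/-- `uv` is a horizontal right edge: same height, smaller first coordinate even. -/
def HorizRight (u v : ℤ × ℤ) : Prop := u.2 = v.2 ∧ Even (min u.1 v.1)

/-- `uv` is a horizontal left edge: same height, smaller first coordinate odd. -/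
def HorizLeft (u v : ℤ × ℤ) : Prop := u.2 = v.2 ∧ Odd (min u.1 v.1)

/-- A right-turn walk: every vertical edge is immediately followed by a horizontal
right edge and immediately preceded by a horizontal left edge. -/
def IsRightTurnWalk (f : ℤ → ℤ × ℤ) : Prop :=
  ∀ i : ℤ, (f i).2 ≠ (f (i + 1)).2 →
    HorizRight (f (i + 1)) (f (i + 2)) ∧ HorizLeft (f (i - 1)) (f i)

/-- The unique neighbor of `W_i` other than `W_{i-1}` and `W_{i+1}`. -/
def thirdNb (f : ℤ → ℤ × ℤ) (i : ℤ) : ℤ × ℤ :=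
  if cwNext (f i) (f (i + 1)) = f (i - 1) then cwNext (f i) (f (i - 1))
  else cwNext (f i) (f (i + 1))

/-- `i ∈ {0,…,k-1}` is a PA-index: `W` makes a left turn at `i` and the third
neighbor of `W_i` has the same height as `W_i`. -/
def IsPAIndex (k : ℕ) (f : ℤ → ℤ × ℤ) (i : ℤ) : Prop :=
  0 ≤ i ∧ i < (k : ℤ) ∧ LeftTurn f i ∧ (thirdNb f i).2 = (f i).2

/-- The horizontal path in the brickwall from `u` to `v` (same height), as a list. -/
def horizPath (u v : ℤ × ℤ) : List (ℤ × ℤ) :=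
  if u.1 ≤ v.1 then (List.range ((v.1 - u.1).toNat + 1)).map fun t => (u.1 + (t : ℤ), u.2)
  else (List.range ((u.1 - v.1).toNat + 1)).map fun t => (u.1 - (t : ℤ), u.2)

/-- `p = {x,y}` is a possible assignment (PA) of the closed walk. -/
def IsPA (k : ℕ) (f : ℤ → ℤ × ℤ) (p : Finset ℤ) : Prop :=
  ∃ x y : ℤ, p = {x, y} ∧ IsPAIndex k f x ∧ IsPAIndex k f y ∧
    f x ≠ f y ∧ (f x).2 = (f y).2 ∧
    ∀ z ∈ horizPath (f x) (f y),
      z ≠ f (x - 1) ∧ z ≠ f (x + 1) ∧ z ≠ f (y - 1) ∧ z ≠ f (y + 1)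

/-- A proper assignment set: a set of PAs forming a non-crossing perfect matching
on the PA-indices. -/
def IsProperAssignment (k : ℕ) (f : ℤ → ℤ × ℤ) (A : Set (Finset ℤ)) : Prop :=
  (∀ p ∈ A, IsPA k f p) ∧
  (∀ i : ℤ, IsPAIndex k f i → ∃! p, p ∈ A ∧ i ∈ p) ∧
  (∀ p ∈ A, ∀ q ∈ A, ∀ i ∈ p, ∀ j ∈ p, ∀ x ∈ q, ∀ y ∈ q, ¬(i < x ∧ x < j ∧ j < y))

/-- `n(i)`: the first PA-index strictly after `i` in cyclic order
(minimizing the cyclic distance `((j - i - 1) mod k) + 1`). -/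
noncomputable def nextPA (k : ℕ) (f : ℤ → ℤ × ℤ) (i : ℤ) : ℤ :=
  if h : ∃ j : ℤ, IsPAIndex k f j ∧ ∀ j' : ℤ, IsPAIndex k f j' →
      (j - i - 1) % (k : ℤ) ≤ (j' - i - 1) % (k : ℤ)
  then h.choose else 0

/-- The subwalk `W_{x,y}` of the closed walk, as a list of `((y-x) mod k) + 1` vertices. -/
def subwalkList (k : ℕ) (f : ℤ → ℤ × ℤ) (x y : ℤ) : List (ℤ × ℤ) :=
  (List.range (((y - x) % (k : ℤ)).toNat + 1)).map fun t => f (x + (t : ℤ))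

/-- The cyclic function `ℤ → ℤ × ℤ` determined by a list of vertices. -/
def listFun (L : List (ℤ × ℤ)) : ℤ → ℤ × ℤ :=
  fun z => L.getD ((z % (L.length : ℤ)).toNat) (0, 0)

/-- An elementary cycle of `(W, A)`, given by its index sequence
`i_0, …, i_l` of PA-indices with `{n(i_t), i_{t+1}} ∈ A`, `{n(i_l), i_0} ∈ A`,
and canonical rotation `i_0 < i_t` for `t ≥ 1`. -/
structure ElemCycle (k : ℕ) (f : ℤ → ℤ × ℤ) (A : Set (Finset ℤ)) where
  l : ℕ
  idx : ℕ → ℤ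
  pa : ∀ t : ℕ, t ≤ l → IsPAIndex k f (idx t)
  mem : ∀ t : ℕ, t < l → ({nextPA k f (idx t), idx (t + 1)} : Finset ℤ) ∈ A
  memLast : ({nextPA k f (idx l), idx 0} : Finset ℤ) ∈ A
  minimal : ∀ t : ℕ, 1 ≤ t → t ≤ l → idx 0 < idx t
  canon : ∀ t : ℕ, l < t → idx t = idx 0

/-- The `t`-th segment `W_{i_t, n(i_t)} ∘ H_{n(i_t), i_{t+1}}` of an elementary
cycle (with final vertex dropped, for concatenation). -/
noncomputable def ecSegment {k : ℕ} {f : ℤ → ℤ × ℤ} {A : Set (Finset ℤ)}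
    (E : ElemCycle k f A) (t : ℕ) : List (ℤ × ℤ) :=
  (subwalkList k f (E.idx t) (nextPA k f (E.idx t))).dropLast ++
  (horizPath (f (nextPA k f (E.idx t))) (f (E.idx (if t = E.l then 0 else t + 1)))).dropLast

/-- The closed walk `C = W_{i_0,n(i_0)} ∘ H_{n(i_0),i_1} ∘ ⋯ ∘ H_{n(i_l),i_0}` of an
elementary cycle, as a list (without the repeated final vertex). -/
noncomputable def ecOpenList {k : ℕ} {f : ℤ → ℤ × ℤ} {A : Set (Finset ℤ)}
    (E : ElemCycle k f A) : List (ℤ × ℤ) :=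
  (List.range (E.l + 1)).flatMap (ecSegment E)

/-- The length of the closed walk of an elementary cycle. -/
noncomputable def ecLen {k : ℕ} {f : ℤ → ℤ × ℤ} {A : Set (Finset ℤ)}
    (E : ElemCycle k f A) : ℕ := (ecOpenList E).length

/-- The closed walk of an elementary cycle, as a periodic function. -/
noncomputable def ecFun {k : ℕ} {f : ℤ → ℤ × ℤ} {A : Set (Finset ℤ)}
    (E : ElemCycle k f A) : ℤ → ℤ × ℤ := listFun (ecOpenList E)

/-- `(m, g)` is (the closed walk of) an elementary cycle of `(W, A)`; if `A = ∅`
and `W` has no PA-index, `W` itself is the unique elementary cycle. -/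
def IsElemCycleWalk (k : ℕ) (f : ℤ → ℤ × ℤ) (A : Set (Finset ℤ))
    (m : ℕ) (g : ℤ → ℤ × ℤ) : Prop :=
  (∃ E : ElemCycle k f A, m = ecLen E ∧ g = ecFun E) ∨
  (A = ∅ ∧ (∀ i : ℤ, ¬ IsPAIndex k f i) ∧ m = k ∧ g = f)

/-- The number of elementary cycles of `(W, A)` (elementary cycles being
identified with their index sequences). -/
noncomputable def numElemCycles (k : ℕ) (f : ℤ → ℤ × ℤ) (A : Set (Finset ℤ)) : ℕ :=
  if A = ∅ ∧ ∀ i : ℤ, ¬ IsPAIndex k f i then 1 else Nat.card (ElemCycle k f A)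

/-- The number of PA-indices of the closed walk. -/
noncomputable def paCount (k : ℕ) (f : ℤ → ℤ × ℤ) : ℕ :=
  Nat.card {i : ℤ // IsPAIndex k f i}

/-- The walk `W' = W_{0,y} ∘ H_{y,0}`, as a list (without repeated final vertex). -/
noncomputable def splitList (k : ℕ) (f : ℤ → ℤ × ℤ) (y : ℤ) : List (ℤ × ℤ) :=
  (subwalkList k f 0 y).dropLast ++ (horizPath (f y) (f 0)).dropLast

/-- The length of the walk `W' = W_{0,y} ∘ H_{y,0}`. -/
noncomputable def splitLen (k : ℕ) (f : ℤ → ℤ × ℤ) (y : ℤ) : ℕ := (splitList k f y).length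

/-- The walk `W' = W_{0,y} ∘ H_{y,0}`, as a periodic function. -/
noncomputable def splitFun (k : ℕ) (f : ℤ → ℤ × ℤ) (y : ℤ) : ℤ → ℤ × ℤ :=
  listFun (splitList k f y)

/-- `Σ_{C ∈ 𝒞} (t(C) - 1)` over the set `𝒞` of elementary cycles of `(W, A)`. -/
noncomputable def elemTurnSum (k : ℕ) (f : ℤ → ℤ × ℤ) (A : Set (Finset ℤ)) : ℚ :=
  if A = ∅ ∧ ∀ i : ℤ, ¬ IsPAIndex k f i then turningNumber k f - 1
  else ∑ᶠ E : ElemCycle k f A, (turningNumber (ecLen E) (ecFun E) - 1)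

/-! ### Noncrossing fixed-point-free involutions on finite linear orders -/

/-- `ν` is the cyclic successor map of a linear order: it sends every element to the next one,
and the greatest element to the least one. -/
def IsCyclicSucc {S : Type*} [LinearOrder S] (ν : S → S) : Prop :=
  ∀ j, (j < ν j ∧ ∀ s, j < s → ν j ≤ s) ∨ ((∀ s, s ≤ j) ∧ ∀ s, ν j ≤ s)

/-- A noncrossing fixed-point-free involution of a linear order. -/
structure IsNoncrossingMatching {S : Type*} [LinearOrder S] (μ : S → S) : Prop where
  involutive : Function.Involutive μ
  ne_self : ∀ a, μ a ≠ a
  noncrossing : ∀ a b, ¬(a < b ∧ b < μ a ∧ μ a < μ b)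

section Matching

variable {S : Type*} [LinearOrder S] {μ ν : S → S}

theorem IsCyclicSucc.injective (hν : IsCyclicSucc ν) : Function.Injective ν := by
  have key : ∀ a b, a < b → ν a ≠ ν b := fun a b h hab => by
    rcases hν a with ⟨h1, h2⟩ | ⟨h1, -⟩
    · rcases hν b with ⟨h3, -⟩ | ⟨-, h4⟩
      · exact (h2 b h).not_gt (hab ▸ h3)
      · exact (h4 a).not_gt (hab ▸ h1)
    · exact (h1 b).not_gt h
  intro a b hab
  by_contra hne
  rcases lt_or_gt_of_ne hne with h | h
  · exact key a b h hab
  · exact key b a h hab.symm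

theorem IsCyclicSucc.lt_of_not_least (hν : IsCyclicSucc ν) {j y : S} (h : ν j = y)
    (hy : ¬∀ s, y ≤ s) : j < y := by
  rcases hν j with ⟨h1, -⟩ | ⟨-, h2⟩
  · exact h ▸ h1
  · exact absurd (h ▸ h2) hy

/-- The inside of an arc is invariant under `μ ∘ ν`. -/
theorem IsNoncrossingMatching.mem_Ico_of_mem_Ico (hμ : IsNoncrossingMatching μ)
    (hν : IsCyclicSucc ν) {i j : S} (hij : i ≤ j) (hji : j < μ i) :
    i ≤ μ (ν j) ∧ μ (ν j) < μ i := by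
  have hinv := hμ.involutive
  rcases hν j with ⟨h1, h2⟩ | ⟨h1, -⟩
  · rcases (h2 _ hji).eq_or_lt with h | h
    · rw [h, hinv i]
      exact ⟨le_rfl, hij.trans_lt hji⟩
    · have hi : i < ν j := hij.trans_lt h1
      have hne : μ (ν j) ≠ μ i := fun e => hi.ne' (hinv.injective e)
      have hne' : μ (ν j) ≠ i := fun e => h.ne (by rw [← e, hinv])
      have c1 := hμ.noncrossing i (ν j)
      have c2 := hμ.noncrossing (μ (ν j)) i
      rw [hinv] at c2
      grind
  · exact absurd (h1 _) hji.not_ge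

/-- The part above the partner of the least element is invariant under `μ ∘ ν`. -/
theorem IsNoncrossingMatching.partner_least_le (hμ : IsNoncrossingMatching μ)
    (hν : IsCyclicSucc ν) {m j : S} (hm : ∀ s, m ≤ s) (hj : μ m ≤ j) : μ m ≤ μ (ν j) := by
  have hinv := hμ.involutive
  rcases hν j with ⟨h1, h2⟩ | ⟨-, h2⟩
  · by_contra! h
    have hne : μ (ν j) ≠ m := fun e => (hj.trans_lt h1).ne' (by rw [← e, hinv])
    refine hμ.noncrossing m (μ (ν j)) ⟨(hm _).lt_of_ne' hne, h, ?_⟩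
    rw [hinv]
    exact hj.trans_lt h1
  · rw [le_antisymm (h2 m) (hm _)]

theorem IsNoncrossingMatching.le_iterate (hμ : IsNoncrossingMatching μ) (hν : IsCyclicSucc ν)
    {m i : S} (hm : ∀ s, m ≤ s) (hi : i < μ i ∨ i = μ m) (t : ℕ) : i ≤ (μ ∘ ν)^[t] i := by
  rcases hi with hi | rfl
  · suffices i ≤ (μ ∘ ν)^[t] i ∧ (μ ∘ ν)^[t] i < μ i from this.1
    induction t with
    | zero => exact ⟨le_rfl, hi⟩
    | succ t ih =>
      rw [Function.iterate_succ_apply']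
      exact hμ.mem_Ico_of_mem_Ico hν ih.1 ih.2
  · induction t with
    | zero => exact le_rfl
    | succ t ih =>
      rw [Function.iterate_succ_apply']
      exact hμ.partner_least_le hν hm ih

theorem IsNoncrossingMatching.two_mul_card_lt [Fintype S] (hμ : IsNoncrossingMatching μ) :
    2 * (Finset.univ.filter fun i => i < μ i).card = Fintype.card S := by
  have h1 : (Finset.univ.filter fun i => ¬ i < μ i).card =
      (Finset.univ.filter fun i => i < μ i).card := by
    refine Finset.card_bij (fun a _ => μ a) ?_ (fun a _ b _ h => hμ.involutive.injective h) ?_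
    · intro a ha
      simp only [Finset.mem_filter, Finset.mem_univ, true_and, not_lt] at ha ⊢
      rw [hμ.involutive]
      exact ha.lt_of_ne (hμ.ne_self a)
    · intro b hb
      simp only [Finset.mem_filter, Finset.mem_univ, true_and] at hb
      exact ⟨μ b, by simp [hμ.involutive b, hb.le], hμ.involutive b⟩
  have h2 := Finset.card_filter_add_card_filter_not (s := Finset.univ) (fun i : S => i < μ i)
  rw [Finset.card_univ] at h2
  omega

theorem IsNoncrossingMatching.card_lt_or_eq [Fintype S] (hμ : IsNoncrossingMatching μ) {m : S}
    (hm : ∀ s, m ≤ s) :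
    Nat.card {i : S // i < μ i ∨ i = μ m} = Nat.card S / 2 + 1 := by
  have h : (Finset.univ.filter fun i => i < μ i ∨ i = μ m) =
      insert (μ m) (Finset.univ.filter fun i => i < μ i) := by
    ext i
    simp [or_comm]
  have hnot : μ m ∉ Finset.univ.filter fun i => i < μ i := by
    simp [hμ.involutive m, hm]
  have hcard := hμ.two_mul_card_lt
  rw [Nat.card_eq_fintype_card, Fintype.card_subtype, h, Finset.card_insert_of_notMem hnot,
    Nat.card_eq_fintype_card]
  omega

end Matching

/-! ### PA-indices of a closed walk -/

section PAIndices

variable {k : ℕ} {f : ℤ → ℤ × ℤ} {A : Set (Finset ℤ)}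

theorem finite_isPAIndex (k : ℕ) (f : ℤ → ℤ × ℤ) : {i : ℤ | IsPAIndex k f i}.Finite :=
  (Set.finite_Ico 0 (k : ℤ)).subset fun _ hi => ⟨hi.1, hi.2.1⟩

theorem nextPA_spec {i : ℤ} (hi : IsPAIndex k f i) :
    IsPAIndex k f (nextPA k f i) ∧ ∀ j, IsPAIndex k f j →
      (nextPA k f i - i - 1) % (k : ℤ) ≤ (j - i - 1) % (k : ℤ) := by
  have h : ∃ j : ℤ, IsPAIndex k f j ∧ ∀ j' : ℤ, IsPAIndex k f j' →
      (j - i - 1) % (k : ℤ) ≤ (j' - i - 1) % (k : ℤ) :=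
    Set.exists_min_image _ (fun j => (j - i - 1) % (k : ℤ)) (finite_isPAIndex k f) ⟨i, hi⟩
  rw [nextPA, dif_pos h]
  exact h.choose_spec

/-- The map `n` on the PA-indices. -/
noncomputable def nextIndex (k : ℕ) (f : ℤ → ℤ × ℤ) (i : {i : ℤ // IsPAIndex k f i}) :
    {i : ℤ // IsPAIndex k f i} :=
  ⟨nextPA k f i, (nextPA_spec i.2).1⟩

theorem emod_sub_one_eq {i j : ℤ} (hi : IsPAIndex k f i) (hj : IsPAIndex k f j) :
    (j - i - 1) % (k : ℤ) = if i < j then j - i - 1 else j - i - 1 + k := by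
  have := hi.1
  have := hi.2.1
  have := hj.1
  have := hj.2.1
  split_ifs with h
  · exact Int.emod_eq_of_lt (by omega) (by omega)
  · rw [← Int.add_emod_right]
    exact Int.emod_eq_of_lt (by omega) (by omega)

theorem isCyclicSucc_nextIndex (k : ℕ) (f : ℤ → ℤ × ℤ) : IsCyclicSucc (nextIndex k f) := by
  rintro ⟨i, hi⟩
  obtain ⟨hn, hmin⟩ := nextPA_spec hi
  have key : ∀ s, IsPAIndex k f s →
      (if i < nextPA k f i then nextPA k f i - i - 1 else nextPA k f i - i - 1 + k) ≤
        if i < s then s - i - 1 else s - i - 1 + k := fun s hs => by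
    rw [← emod_sub_one_eq hi hn, ← emod_sub_one_eq hi hs]
    exact hmin s hs
  simp only [nextIndex, Subtype.forall, Subtype.mk_lt_mk, Subtype.mk_le_mk]
  have := hi.1
  have := hn.1
  have := hn.2.1
  by_cases h : i < nextPA k f i
  · refine Or.inl ⟨h, fun s hs his => ?_⟩
    have := key s hs
    rw [if_pos h, if_pos his] at this
    omega
  · have hle : ∀ s, IsPAIndex k f s → s ≤ i := fun s hs => by
      by_contra! his
      have h3 := key s hs
      have := hs.2.1
      rw [if_neg h, if_pos his] at h3
      omega
    refine Or.inr ⟨hle, fun s hs => ?_⟩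
    have h3 := key s hs
    rw [if_neg h, if_neg (hle s hs).not_gt] at h3
    omega

theorem IsPA.ne {x y : ℤ} (h : IsPA k f {x, y}) : x ≠ y := by
  rintro rfl
  obtain ⟨a, b, hab, -, -, hne, -⟩ := h
  have ha : a ∈ ({x, x} : Finset ℤ) := hab ▸ by simp
  have hb : b ∈ ({x, x} : Finset ℤ) := hab ▸ by simp
  simp only [Finset.mem_insert, Finset.mem_singleton, or_self] at ha hb
  exact hne (by rw [ha, hb])

theorem IsProperAssignment.exists_partner (hA : IsProperAssignment k f A)
    (i : {i : ℤ // IsPAIndex k f i}) :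
    ∃ j : {i : ℤ // IsPAIndex k f i}, ({i.1, j.1} : Finset ℤ) ∈ A := by
  obtain ⟨p, ⟨hp, hip⟩, -⟩ := hA.2.1 i i.2
  obtain ⟨x, y, rfl, hx, hy, -⟩ := hA.1 p hp
  simp only [Finset.mem_insert, Finset.mem_singleton] at hip
  rcases hip with h | h
  · exact ⟨⟨y, hy⟩, by rwa [h]⟩
  · exact ⟨⟨x, hx⟩, by rwa [h, Finset.pair_comm]⟩

/-- The PA-index assigned to a given PA-index. -/
noncomputable def partner (hA : IsProperAssignment k f A) (i : {i : ℤ // IsPAIndex k f i}) :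
    {i : ℤ // IsPAIndex k f i} :=
  (hA.exists_partner i).choose

theorem pair_partner_mem (hA : IsProperAssignment k f A) (i : {i : ℤ // IsPAIndex k f i}) :
    ({i.1, (partner hA i).1} : Finset ℤ) ∈ A :=
  (hA.exists_partner i).choose_spec

theorem pair_mem_iff (hA : IsProperAssignment k f A) {i j : {i : ℤ // IsPAIndex k f i}} :
    ({i.1, j.1} : Finset ℤ) ∈ A ↔ j = partner hA i := by
  refine ⟨fun h => ?_, fun h => h ▸ pair_partner_mem hA i⟩
  have heq := (hA.2.1 i i.2).unique ⟨h, by simp⟩ ⟨pair_partner_mem hA i, by simp⟩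
  have hj : j.1 ∈ ({i.1, (partner hA i).1} : Finset ℤ) := heq ▸ by simp
  simp only [Finset.mem_insert, Finset.mem_singleton] at hj
  exact Subtype.ext (hj.resolve_left (hA.1 _ h).ne.symm)

theorem isNoncrossingMatching_partner (hA : IsProperAssignment k f A) :
    IsNoncrossingMatching (partner hA) where
  involutive i := by
    symm
    rw [← pair_mem_iff, Finset.pair_comm]
    exact pair_partner_mem hA i
  ne_self i h := (hA.1 _ (pair_partner_mem hA i)).ne (congrArg Subtype.val h.symm)
  noncrossing a b := hA.2.2 _ (pair_partner_mem hA a) _ (pair_partner_mem hA b) a (by simp) _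
    (by simp) b (by simp) _ (by simp)

/-- The transition between the consecutive indices of an elementary cycle. -/
noncomputable def transition (hA : IsProperAssignment k f A) :
    {i : ℤ // IsPAIndex k f i} → {i : ℤ // IsPAIndex k f i} :=
  partner hA ∘ nextIndex k f

theorem pair_nextPA_mem_iff (hA : IsProperAssignment k f A)
    {i j : {i : ℤ // IsPAIndex k f i}} :
    ({nextPA k f i.1, j.1} : Finset ℤ) ∈ A ↔ j = transition hA i :=
  pair_mem_iff hA (i := nextIndex k f i)

end PAIndices

/-! ### Counting elementary cycles by their first index -/

namespace ElemCycle

variable {k : ℕ} {f : ℤ → ℤ × ℤ} {A : Set (Finset ℤ)}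

/-- The first (and least) index of an elementary cycle. -/
def start (E : ElemCycle k f A) : {i : ℤ // IsPAIndex k f i} := ⟨E.idx 0, E.pa 0 E.l.zero_le⟩

theorem idx_eq_iterate (hA : IsProperAssignment k f A) (E : ElemCycle k f A) {t : ℕ}
    (ht : t ≤ E.l) : E.idx t = ((transition hA)^[t] E.start).1 := by
  induction t with
  | zero => rfl
  | succ t ih =>
    rw [Function.iterate_succ_apply']
    have h := E.mem t ht
    rw [ih (by omega)] at h
    exact congrArg Subtype.val ((pair_nextPA_mem_iff hA (j := ⟨_, E.pa _ ht⟩)).1 h)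

theorem iterate_succ_l (hA : IsProperAssignment k f A) (E : ElemCycle k f A) :
    (transition hA)^[E.l + 1] E.start = E.start := by
  have h := E.memLast
  rw [E.idx_eq_iterate hA le_rfl] at h
  rw [Function.iterate_succ_apply']
  exact ((pair_nextPA_mem_iff hA (j := E.start)).1 h).symm

theorem l_le_l (hA : IsProperAssignment k f A) {E E' : ElemCycle k f A}
    (h : E.start = E'.start) : E'.l ≤ E.l := by
  by_contra! hlt
  have hmin := E'.minimal (E.l + 1) (by omega) hlt
  rw [E'.idx_eq_iterate hA hlt, ← h, E.iterate_succ_l hA, h] at hmin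
  exact lt_irrefl _ hmin

theorem start_injective (hA : IsProperAssignment k f A) :
    Function.Injective (start : ElemCycle k f A → _) := by
  intro E E' h
  have hl : E.l = E'.l := le_antisymm (l_le_l hA h.symm) (l_le_l hA h)
  have hidx : E.idx = E'.idx := by
    funext t
    rcases le_or_gt t E.l with ht | ht
    · rw [E.idx_eq_iterate hA ht, E'.idx_eq_iterate hA (hl ▸ ht), h]
    · rw [E.canon t ht, E'.canon t (hl ▸ ht)]
      exact congrArg Subtype.val h
  cases E
  cases E'
  cases hl
  cases hidx
  rfl

theorem start_lt_or_eq (hA : IsProperAssignment k f A) (E : ElemCycle k f A)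
    {m : {i : ℤ // IsPAIndex k f i}} (hm : ∀ s, m ≤ s) :
    E.start < partner hA E.start ∨ E.start = partner hA m := by
  have hμ := isNoncrossingMatching_partner hA
  by_contra! hcon
  obtain ⟨h1, h2⟩ := hcon
  set j : {i : ℤ // IsPAIndex k f i} := ⟨E.idx E.l, E.pa _ le_rfl⟩
  have hstart : E.start = transition hA j := (pair_nextPA_mem_iff hA).1 E.memLast
  have hnext : nextIndex k f j = partner hA E.start := by
    rw [hstart]
    exact (hμ.involutive _).symm
  have hlt : j < partner hA E.start := by
    refine (isCyclicSucc_nextIndex k f).lt_of_not_least hnext fun hleast => h2 ?_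
    rw [← hμ.involutive E.start, le_antisymm (hm _) (hleast m)]
  have hle : E.start ≤ j := by
    change E.idx 0 ≤ E.idx E.l
    rcases Nat.eq_zero_or_pos E.l with h0 | h0
    · rw [h0]
    · exact (E.minimal _ h0 le_rfl).le
  exact absurd (hlt.trans_le h1) hle.not_gt

theorem exists_start_eq (hA : IsProperAssignment k f A) {m i : {i : ℤ // IsPAIndex k f i}}
    (hm : ∀ s, m ≤ s) (hi : i < partner hA i ∨ i = partner hA m) :
    ∃ E : ElemCycle k f A, E.start = i := by
  have hμ := isNoncrossingMatching_partner hA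
  have hν := isCyclicSucc_nextIndex k f
  have : Finite {i : ℤ // IsPAIndex k f i} := (finite_isPAIndex k f).to_subtype
  have hinj : Function.Injective (transition hA) := hμ.involutive.injective.comp hν.injective
  have hpos : 0 < Function.minimalPeriod (transition hA) i :=
    Function.minimalPeriod_pos_of_mem_periodicPts (hinj.mem_periodicPts i)
  obtain ⟨l, hl⟩ : ∃ l, Function.minimalPeriod (transition hA) i = l + 1 :=
    ⟨_, (Nat.succ_pred_eq_of_pos hpos).symm⟩
  refine ⟨{ l := l
            idx := fun t => if t ≤ l then ((transition hA)^[t] i).1 else i.1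
            pa := ?_, mem := ?_, memLast := ?_, minimal := ?_, canon := ?_ }, ?_⟩
  · intro t ht
    rw [if_pos ht]
    exact Subtype.prop _
  · intro t ht
    rw [if_pos ht.le, if_pos (Nat.succ_le_of_lt ht), pair_nextPA_mem_iff hA,
      Function.iterate_succ_apply']
  · rw [if_pos le_rfl, if_pos l.zero_le, pair_nextPA_mem_iff hA,
      ← Function.iterate_succ_apply' (transition hA), Nat.succ_eq_add_one, ← hl,
      Function.iterate_minimalPeriod]
    rfl
  · intro t h1 ht
    rw [if_pos ht, if_pos l.zero_le]
    refine lt_of_le_of_ne (hμ.le_iterate hν hm hi t) fun h => ?_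
    exact Function.not_isPeriodicPt_of_pos_of_lt_minimalPeriod (by omega) (by omega)
      (Subtype.ext h.symm : (transition hA)^[t] i = i)
  · intro t ht
    rw [if_neg ht.not_ge, if_pos l.zero_le]
    rfl
  · exact Subtype.ext (by simp [start])

theorem card_eq (hA : IsProperAssignment k f A) (hne : ∃ i, IsPAIndex k f i) :
    Nat.card (ElemCycle k f A) = paCount k f / 2 + 1 := by
  have : Finite {i : ℤ // IsPAIndex k f i} := (finite_isPAIndex k f).to_subtype
  have : Fintype {i : ℤ // IsPAIndex k f i} := Fintype.ofFinite _
  have : Nonempty {i : ℤ // IsPAIndex k f i} := hne.elim fun i hi => ⟨⟨i, hi⟩⟩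
  obtain ⟨m, hm⟩ := Finite.exists_min (id : {i : ℤ // IsPAIndex k f i} → _)
  rw [paCount, ← (isNoncrossingMatching_partner hA).card_lt_or_eq hm]
  refine Nat.card_eq_of_bijective (fun E => ⟨E.start, E.start_lt_or_eq hA hm⟩) ⟨?_, ?_⟩
  · exact fun E E' h => start_injective hA (congrArg Subtype.val h)
  · rintro ⟨i, hi⟩
    obtain ⟨E, hE⟩ := exists_start_eq hA hm hi
    exact ⟨E, Subtype.ext hE⟩

end ElemCycle

/-- Let `A` be a proper assignment set for a closed walk `W` in the
brickwall, and let `p` be the number of PA-indices of `W`. Then the number of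
elementary cycles of `(W, A)` is `p/2 + 1`. -/
theorem numElemCycles_eq
    (k : ℕ) (f : ℤ → ℤ × ℤ) (A : Set (Finset ℤ))
    (hW : IsClosedWalk k f) (hA : IsProperAssignment k f A) :
    numElemCycles k f A = paCount k f / 2 + 1 := by
  by_cases hne : ∃ i, IsPAIndex k f i
  · rw [numElemCycles, if_neg fun h => hne.elim h.2]
    exact ElemCycle.card_eq hA hne
  · push Not at hne
    have hempty : A = ∅ := Set.eq_empty_of_forall_notMem fun p hp => by
      obtain ⟨x, -, -, hx, -⟩ := hA.1 p hp
      exact hne x hx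
    have : IsEmpty {i : ℤ // IsPAIndex k f i} := ⟨fun i => hne i.1 i.2⟩
    rw [numElemCycles, if_pos ⟨hempty, hne⟩, paCount, Nat.card_of_isEmpty]

end Hex
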